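/- Let Λ_Y denote the integral lattice ℤ^16 equipped with the symmetric bilinear form whose Gram matrix is block diagonal with: three 2×2 blocks [[0,2],[2,0]], one 8×8 block equal to the negative of the Cartan matrix of E8, and two 1×1 blocks (−2). Then for every primitive vector v ∈ Λ_Y, the ideal {(v,x) : x ∈ Λ_Y} ⊆ ℤ contains 2ℤ; equivalently, the divisibility of every primitive vector of Λ_Y is either 1 or 2. -/

import Mathlib

open Matrix

/-- A 6×6 matrix made of three 2×2 diagonal blocks `[[0,c],[c,0]]`
(the pairs of indices {0,1}, {2,3}, {4,5}). -/
def Ublock (c : ℤ) : Matrix (Fin 6) (Fin 6) ℤ :=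
  fun i j => if i ≠ j ∧ i.val / 2 = j.val / 2 then c else 0

def eqY : (Fin 6 ⊕ Fin 8) ⊕ Fin 2 ≃ Fin 16 :=
  (Equiv.sumCongr finSumFinEquiv (Equiv.refl (Fin 2))).trans finSumFinEquiv

/-- Gram matrix of `Λ_Y = U(2)^3 ⊕ E8(-1) ⊕ ⟨-2⟩^2` on `ℤ^16`:
coordinates 0–5 carry three blocks `[[0,2],[2,0]]`, coordinates 6–13 carry `-E₈`,
coordinates 14, 15 carry `(-2)` each. -/
def GramY : Matrix (Fin 16) (Fin 16) ℤ :=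
  (Matrix.reindex eqY eqY)
    (Matrix.fromBlocks
      (Matrix.fromBlocks (Ublock 2) 0 0 (-CartanMatrix.E₈)) 0 0
      (Matrix.diagonal fun _ => -2))

def pairY (x y : Fin 16 → ℤ) : ℤ := x ⬝ᵥ (GramY *ᵥ y)

/-- `v` is primitive: it is not a multiple `n • w` with `n ≥ 2`. -/
def IsPrimitive (v : Fin 16 → ℤ) : Prop :=
  ∀ n : ℤ, 2 ≤ n → ∀ w : Fin 16 → ℤ, v ≠ n • w

/-- A primitive integral vector admits a Bézout relation among its coordinates. -/
theorem IsPrimitive.exists_dotProduct_eq_one {v : Fin 16 → ℤ} (hv : IsPrimitive v) :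
    ∃ y : Fin 16 → ℤ, v ⬝ᵥ y = 1 := by
  obtain ⟨g, hg⟩ := (IsPrincipalIdealRing.principal (Ideal.span (Set.range v))).principal
  have hdvd : ∀ i, g ∣ v i := fun i =>
    Ideal.mem_span_singleton.mp
      (hg.le (Ideal.subset_span (Set.mem_range_self i) : v i ∈ Ideal.span (Set.range v)))
  have hunit : IsUnit g := by
    rw [Int.isUnit_iff_natAbs_eq]
    by_contra hne
    obtain ⟨n, hn, hng⟩ : ∃ n : ℤ, 2 ≤ n ∧ ∀ i, n ∣ v i := by
      rcases eq_or_ne g 0 with rfl | h0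
      · exact ⟨2, le_rfl, fun i => (zero_dvd_iff.mp (hdvd i)) ▸ dvd_zero 2⟩
      · exact ⟨|g|, by rw [Int.abs_eq_natAbs]; omega, fun i => (abs_dvd g _).mpr (hdvd i)⟩
    choose w hw using hng
    exact hv n hn w (funext hw)
  have hone : (1 : ℤ) ∈ Ideal.span (Set.range v) := by
    rw [hg]
    exact Ideal.mem_span_singleton.mpr hunit.dvd
  obtain ⟨y, hy⟩ := Ideal.mem_span_range_iff_exists_fun.mp hone
  exact ⟨y, by rw [dotProduct_comm]; exact hy⟩

theorem Ublock_two_mul_Ublock_one : Ublock 2 * Ublock 1 = 2 := by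
  decide

/-- Twice the inverse Gram matrix of `Λ_Y` is integral. -/
theorem exists_GramY_mul_eq_two : ∃ D : Matrix (Fin 16) (Fin 16) ℤ, GramY * D = 2 := by
  have hE : CartanMatrix.E₈ * CartanMatrix.E₈⁻¹ = 1 :=
    Matrix.mul_nonsing_inv _ (by rw [CartanMatrix.E₈_det]; exact isUnit_one)
  refine ⟨Matrix.reindex eqY eqY
    (Matrix.fromBlocks
      (Matrix.fromBlocks (Ublock 1) 0 0 (-CartanMatrix.E₈⁻¹ * 2)) 0 0
      (Matrix.diagonal fun _ => -1)), ?_⟩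
  have hblocks : (Matrix.fromBlocks (Matrix.fromBlocks 2 0 0 2) 0 0 2 :
      Matrix ((Fin 6 ⊕ Fin 8) ⊕ Fin 2) ((Fin 6 ⊕ Fin 8) ⊕ Fin 2) ℤ) = 1 + 1 := by
    simp only [← one_add_one_eq_two, ← Matrix.fromBlocks_one, Matrix.fromBlocks_add, add_zero]
  have htwo : Matrix.diagonal (fun _ : Fin 2 => (2 : ℤ) * 1) = 2 := by decide
  simp only [GramY, Matrix.reindex_apply, Matrix.submatrix_mul_equiv, Matrix.fromBlocks_multiply,
    Matrix.mul_zero, Matrix.zero_mul, add_zero, zero_add, Ublock_two_mul_Ublock_one,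
    ← Matrix.mul_assoc, neg_mul_neg, hE, Matrix.one_mul, Matrix.diagonal_mul_diagonal, htwo,
    hblocks]
  simp only [Matrix.submatrix_add, Pi.add_apply, Matrix.submatrix_one_equiv]
  exact one_add_one_eq_two

/-- For every primitive `v ∈ Λ_Y`, the ideal `{(v,x) : x ∈ Λ_Y}` contains `2ℤ`;
equivalently the divisibility of `v` is `1` or `2`. -/
theorem stmt7 (v : Fin 16 → ℤ) (hv : IsPrimitive v) :
    ∀ c : ℤ, 2 ∣ c → ∃ x : Fin 16 → ℤ, pairY v x = c := by
  rintro c ⟨k, rfl⟩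
  obtain ⟨y, hy⟩ := hv.exists_dotProduct_eq_one
  obtain ⟨D, hD⟩ := exists_GramY_mul_eq_two
  refine ⟨k • D *ᵥ y, ?_⟩
  rw [pairY, Matrix.mulVec_smul, Matrix.mulVec_mulVec, hD, ← one_add_one_eq_two,
    Matrix.add_mulVec, Matrix.one_mulVec, dotProduct_smul, dotProduct_add, hy, smul_eq_mul]
  ring
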